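/- For all partitions λ and μ, the reflection identity Ñ_{λ,μ}(z) = Ñ_{μ,λ}(q3 z^{−1}) holds in ℚ(q1,q2,z); equivalently, N_{λ,μ}(z) = N_{μ,λ}(q3 z^{−1}) · ∏_{c∈λ} (−q3^{−1} z χ_c) · ∏_{c'∈μ} (−z χ_{c'}^{−1}). -/

import Mathlib

open scoped BigOperators

noncomputable section

/-- The field `ℚ(q1, q2, z)` of rational functions in three independent indeterminates. -/
abbrev K : Type := FractionRing (MvPolynomial (Fin 3) ℚ)

/-- The indeterminate `q1`. -/
def q1 : K := algebraMap (MvPolynomial (Fin 3) ℚ) K (MvPolynomial.X 0)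

/-- The indeterminate `q2`. -/
def q2 : K := algebraMap (MvPolynomial (Fin 3) ℚ) K (MvPolynomial.X 1)

/-- The indeterminate `z`. -/
def z : K := algebraMap (MvPolynomial (Fin 3) ℚ) K (MvPolynomial.X 2)

/-- `q3 = (q1 q2)⁻¹`. -/
def q3 : K := (q1 * q2)⁻¹

/-- Box content `χ_c = q1^(i-1) * q2^(j-1)` of the 1-indexed cell `(i,j)`.
Here cells of a `YoungDiagram` are 0-indexed, so the cell `c` corresponding to the
1-indexed cell `(i,j)` is `c = (i-1, j-1)` and `χ_c = q1^c.1 * q2^c.2`. -/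
def chi (c : ℕ × ℕ) : K := q1 ^ c.1 * q2 ^ c.2

/-- `c` is an addable cell of the Young diagram `d`: it is not a cell of `d` and adjoining
it again gives (the cells of) a Young diagram. -/
def IsAddable (d : YoungDiagram) (c : ℕ × ℕ) : Prop :=
  c ∉ d.cells ∧ IsLowerSet (↑(insert c d.cells) : Set (ℕ × ℕ))

/-- `c` is a removable cell of the Young diagram `d`: it is a cell of `d` and deleting
it again gives (the cells of) a Young diagram. -/
def IsRemovable (d : YoungDiagram) (c : ℕ × ℕ) : Prop :=
  c ∈ d.cells ∧ IsLowerSet (↑(d.cells.erase c) : Set (ℕ × ℕ))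

open Classical in
/-- The (finite) set `A(d)` of addable cells of `d`; every addable cell `(i,j)` satisfies
`i ≤ colLen 0` and `j ≤ rowLen 0`, so filtering the bounding box captures all of them. -/
noncomputable def addables (d : YoungDiagram) : Finset (ℕ × ℕ) :=
  (Finset.range (d.colLen 0 + 1) ×ˢ Finset.range (d.rowLen 0 + 1)).filter (IsAddable d)

open Classical in
/-- The (finite) set `R(d)` of removable cells of `d`. -/
noncomputable def removables (d : YoungDiagram) : Finset (ℕ × ℕ) :=
  d.cells.filter (IsRemovable d)

/-- The (K-theoretic) Nekrasov factor
`N_{λ,μ}(w) = ∏_{(i,j)∈λ} (1 − w q1^{λ^T_j − i + 1} q2^{j − μ_i})`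
`           · ∏_{(i,j)∈μ} (1 − w q1^{i − μ^T_j} q2^{λ_i − j + 1})`
written in terms of 0-indexed cells (`λ^T_j = colLen (j-1)`, `λ_i = rowLen (i-1)`). -/
def nek (lam mu : YoungDiagram) (w : K) : K :=
  (∏ c ∈ lam.cells,
      (1 - w * q1 ^ ((lam.colLen c.2 : ℤ) - (c.1 : ℤ)) *
        q2 ^ ((c.2 : ℤ) + 1 - (mu.rowLen c.1 : ℤ)))) *
    ∏ c ∈ mu.cells,
      (1 - w * q1 ^ ((c.1 : ℤ) + 1 - (mu.colLen c.2 : ℤ)) *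
        q2 ^ ((lam.rowLen c.1 : ℤ) - (c.2 : ℤ)))

/-- The modified Nekrasov factor `Ñ_{λ,μ}(w) = N_{λ,μ}(w) · ∏_{c∈λ} (−q3⁻¹ w χ_c)⁻¹`. -/
def nekT (lam mu : YoungDiagram) (w : K) : K :=
  nek lam mu w * (∏ c ∈ lam.cells, (-q3⁻¹ * w * chi c))⁻¹

lemma aux_q1_ne : q1 ≠ 0 := by
  unfold q1
  exact (map_ne_zero_iff _ (IsFractionRing.injective (MvPolynomial (Fin 3) ℚ) K)).2
    (MvPolynomial.X_ne_zero _)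

lemma aux_q2_ne : q2 ≠ 0 := by
  unfold q2
  exact (map_ne_zero_iff _ (IsFractionRing.injective (MvPolynomial (Fin 3) ℚ) K)).2
    (MvPolynomial.X_ne_zero _)

lemma aux_z_ne : z ≠ 0 := by
  unfold z
  exact (map_ne_zero_iff _ (IsFractionRing.injective (MvPolynomial (Fin 3) ℚ) K)).2
    (MvPolynomial.X_ne_zero _)

lemma aux_prod_zpow {F ι : Type*} [Field F] (a : F) (ha : a ≠ 0) (s : Finset ι) (f : ι → ℤ) :
    ∏ i ∈ s, a ^ f i = a ^ ∑ i ∈ s, f i := by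
  classical
  induction s using Finset.induction_on with
  | empty => simp
  | insert x s hx ih => rw [Finset.prod_insert hx, Finset.sum_insert hx, ih, zpow_add₀ ha]

lemma aux_leg (d : YoungDiagram) :
    ∑ c ∈ d.cells, ((d.colLen c.2 : ℤ) - (c.1 : ℤ)) = ∑ c ∈ d.cells, ((c.1 : ℤ) + 1) := by
  have key : ∀ c ∈ d.cells, c.1 < d.colLen c.2 := fun c hc =>
    YoungDiagram.mem_iff_lt_colLen.1 ((YoungDiagram.mem_cells _).1 hc)
  have key2 : ∀ c ∈ d.cells, (d.colLen c.2 - 1 - c.1, c.2) ∈ d.cells := fun c hc => by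
    have := key c hc
    exact (YoungDiagram.mem_cells _).2 (YoungDiagram.mem_iff_lt_colLen.2 (by omega))
  refine Finset.sum_nbij' (fun c => (d.colLen c.2 - 1 - c.1, c.2))
    (fun c => (d.colLen c.2 - 1 - c.1, c.2)) key2 key2 ?_ ?_ ?_
  · intro c hc
    have := key c hc
    ext <;> simp; omega
  · intro c hc
    have := key c hc
    ext <;> simp; omega
  · intro c hc
    have := key c hc
    simp only
    omega

lemma aux_row (d : YoungDiagram) (i : ℕ) :
    (d.rowLen i : ℤ) = ∑ c ∈ d.cells, if c.1 = i then (1 : ℤ) else 0 := by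
  rw [YoungDiagram.rowLen_eq_card, YoungDiagram.row, Finset.card_filter]
  push_cast
  rfl

lemma aux_arm (d e : YoungDiagram) :
    ∑ c ∈ d.cells, (e.rowLen c.1 : ℤ) = ∑ c ∈ e.cells, (d.rowLen c.1 : ℤ) := by
  simp only [aux_row]
  rw [Finset.sum_comm]
  simp only [eq_comm]

lemma aux_mono (lam mu : YoungDiagram) :
    (∏ c ∈ lam.cells, (-z * q1 ^ ((lam.colLen c.2 : ℤ) - (c.1 : ℤ)) *
        q2 ^ ((c.2 : ℤ) + 1 - (mu.rowLen c.1 : ℤ)))) *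
    ∏ c ∈ mu.cells, (-z * q1 ^ ((c.1 : ℤ) + 1 - (mu.colLen c.2 : ℤ)) *
        q2 ^ ((lam.rowLen c.1 : ℤ) - (c.2 : ℤ))) =
    (∏ c ∈ lam.cells, (-q3⁻¹ * z * chi c)) * ∏ c' ∈ mu.cells, (-z * (chi c')⁻¹) := by
  have h1 : ∀ c : ℕ × ℕ, -q3⁻¹ * z * chi c = -z * q1 ^ ((c.1 : ℤ) + 1) * q2 ^ ((c.2 : ℤ) + 1) := by
    intro c
    rw [zpow_add₀ aux_q1_ne, zpow_add₀ aux_q2_ne, q3, chi]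
    simp only [inv_inv, zpow_natCast, zpow_one]
    ring
  have h2 : ∀ c : ℕ × ℕ, -z * (chi c)⁻¹ = -z * q1 ^ (-(c.1 : ℤ)) * q2 ^ (-(c.2 : ℤ)) := by
    intro c
    rw [chi, zpow_neg, zpow_neg, zpow_natCast, zpow_natCast, mul_inv]
    ring
  simp only [h1, h2, Finset.prod_mul_distrib, aux_prod_zpow q1 aux_q1_ne,
    aux_prod_zpow q2 aux_q2_ne]
  have e1 := aux_leg lam
  have e2 : ∑ c ∈ mu.cells, ((c.1 : ℤ) + 1 - (mu.colLen c.2 : ℤ)) =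
      ∑ c ∈ mu.cells, (-(c.1 : ℤ)) := by
    have := aux_leg mu
    simp only [Finset.sum_sub_distrib, Finset.sum_add_distrib, Finset.sum_neg_distrib] at this ⊢
    linarith
  have e3 : ∑ c ∈ lam.cells, ((c.2 : ℤ) + 1 - (mu.rowLen c.1 : ℤ)) +
      ∑ c ∈ mu.cells, ((lam.rowLen c.1 : ℤ) - (c.2 : ℤ)) =
      ∑ c ∈ lam.cells, ((c.2 : ℤ) + 1) + ∑ c ∈ mu.cells, (-(c.2 : ℤ)) := by
    have := aux_arm lam mu
    simp only [Finset.sum_sub_distrib, Finset.sum_neg_distrib] at this ⊢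
    linarith
  have e3' := congrArg (fun n : ℤ => q2 ^ n) e3
  simp only [zpow_add₀ aux_q2_ne] at e3'
  rw [e1, e2]
  linear_combination (∏ c ∈ lam.cells, -z) * (∏ c ∈ mu.cells, -z) *
    q1 ^ (∑ c ∈ lam.cells, ((c.1 : ℤ) + 1)) * q1 ^ (∑ c ∈ mu.cells, (-(c.1 : ℤ))) * e3'

lemma aux_term (m n m' n' : ℤ) (hm : m' = 1 - m) (hn : n' = 1 - n) :
    1 - z * q1 ^ m * q2 ^ n =
      (1 - q3 * z⁻¹ * q1 ^ m' * q2 ^ n') * (-z * q1 ^ m * q2 ^ n) := by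
  subst hm hn
  have h1 := aux_q1_ne
  have h2 := aux_q2_ne
  have h3 := aux_z_ne
  have a1 : q1 ^ m ≠ 0 := zpow_ne_zero _ h1
  have a2 : q2 ^ n ≠ 0 := zpow_ne_zero _ h2
  rw [zpow_sub₀ h1, zpow_sub₀ h2, q3, zpow_one, zpow_one]
  generalize q1 ^ m = x at *
  generalize q2 ^ n = y at *
  field_simp
  ring

lemma aux_main (lam mu : YoungDiagram) :
    nek lam mu z
        = nek mu lam (q3 * z⁻¹) * (∏ c ∈ lam.cells, (-q3⁻¹ * z * chi c)) *
            ∏ c' ∈ mu.cells, (-z * (chi c')⁻¹) := by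
  rw [mul_assoc, ← aux_mono, nek, nek]
  rw [Finset.prod_congr rfl (fun c _ => aux_term ((lam.colLen c.2 : ℤ) - (c.1 : ℤ))
    ((c.2 : ℤ) + 1 - (mu.rowLen c.1 : ℤ)) ((c.1 : ℤ) + 1 - (lam.colLen c.2 : ℤ))
    ((mu.rowLen c.1 : ℤ) - (c.2 : ℤ)) (by ring) (by ring))]
  rw [Finset.prod_congr (s₁ := mu.cells) rfl (fun c _ => aux_term
    ((c.1 : ℤ) + 1 - (mu.colLen c.2 : ℤ)) ((lam.rowLen c.1 : ℤ) - (c.2 : ℤ))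
    ((mu.colLen c.2 : ℤ) - (c.1 : ℤ))
    ((c.2 : ℤ) + 1 - (lam.rowLen c.1 : ℤ)) (by ring) (by ring))]
  rw [Finset.prod_mul_distrib (s := lam.cells) (f := fun c => 1 - _),
    Finset.prod_mul_distrib (s := mu.cells) (f := fun c => 1 - _), mul_mul_mul_comm]
  congr 1
  exact mul_comm _ _

/-- For all partitions `λ, μ`, in `ℚ(q1,q2,z)`: the reflection identity
`Ñ_{λ,μ}(z) = Ñ_{μ,λ}(q3 z⁻¹)`, equivalently
`N_{λ,μ}(z) = N_{μ,λ}(q3 z⁻¹) · ∏_{c∈λ} (−q3⁻¹ z χ_c) · ∏_{c'∈μ} (−z χ_{c'}⁻¹)`. -/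
theorem stmt5 (lam mu : YoungDiagram) :
    nekT lam mu z = nekT mu lam (q3 * z⁻¹) ∧
      nek lam mu z
        = nek mu lam (q3 * z⁻¹) * (∏ c ∈ lam.cells, (-q3⁻¹ * z * chi c)) *
            ∏ c' ∈ mu.cells, (-z * (chi c')⁻¹) := by
  refine ⟨?_, aux_main lam mu⟩
  have h1 := aux_q1_ne
  have h2 := aux_q2_ne
  have h3 := aux_z_ne
  have hq3 : q3 ≠ 0 := inv_ne_zero (mul_ne_zero h1 h2)
  have hne : (∏ c ∈ lam.cells, (-q3⁻¹ * z * chi c)) ≠ 0 :=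
    Finset.prod_ne_zero_iff.2 fun c _ => mul_ne_zero
      (mul_ne_zero (neg_ne_zero.2 (inv_ne_zero hq3)) h3)
      (mul_ne_zero (pow_ne_zero _ h1) (pow_ne_zero _ h2))
  have hmu : (∏ c ∈ mu.cells, (-q3⁻¹ * (q3 * z⁻¹) * chi c))⁻¹ =
      ∏ c' ∈ mu.cells, (-z * (chi c')⁻¹) := by
    rw [← Finset.prod_inv_distrib]
    refine Finset.prod_congr rfl fun c _ => ?_
    have : -q3⁻¹ * (q3 * z⁻¹) * chi c = -(z⁻¹ * chi c) := by
      rw [neg_mul, inv_mul_cancel_left₀ hq3, neg_mul]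
    rw [this, inv_neg, mul_inv, inv_inv, neg_mul]
  rw [nekT, nekT, hmu, aux_main lam mu, mul_right_comm, mul_inv_cancel_right₀ hne]

end
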